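/- Let s > 1, assume m ≥ 2, and suppose Y_s := sup_{k≥0} |y_k| (m+k)^s < ∞. Let M be an integer satisfying M ≥ max( (−m ln√θ − s − s_L − 1 − √((m ln√θ + s + s_L + 1)² − 4 m ln√θ)) / (2 ln√θ), 4/(ln θ)², m ). Define χ = θ^{M/2} (M/2) ((m+M)/m)^{s+s_L} + θ^{√M} (M/2) 2^{s+s_L} + (1/(1−θ)) ((m+M)/(m+M−√M−1))^{s+s_L}. Then for every k ≥ M, |(G y)_k| (m+k)^{s+s_L} ≤ (η Y_s / C₁) ( χ + θ/(1−θ) ). -/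

import Mathlib

/-- The general term (index `l`) of the series defining `x = U⁻¹ z`:
`(−1)^l (δ_k/δ_{k+l+1}) c_{k+1}⋯c_{k+l} z_{k+l}`. -/
noncomputable def Uterm (c d z : ℕ → ℝ) (k l : ℕ) : ℝ :=
  (-1 : ℝ) ^ l * (d k / d (k + l + 1)) * (∏ i ∈ Finset.range l, c (k + 1 + i)) * z (k + l)

/-- `U⁻¹ z` : `(U⁻¹z)_k = (δ_k/δ_{k+1}) z_k + Σ_{l=1}^{∞} (−1)^l (δ_k/δ_{k+l+1})
c_{k+1}⋯c_{k+l} z_{k+l}`. -/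
noncomputable def Uinv (c d z : ℕ → ℝ) (k : ℕ) : ℝ :=
  d k / d (k + 1) * z k + ∑' l : ℕ, Uterm c d z k (l + 1)

/-- Discrete convolution of a sequence with the geometric sequence of ratio `θ`. -/
noncomputable def geomConv (θ : ℝ) (w : ℕ → ℝ) (n : ℕ) : ℝ :=
  ∑ l ∈ Finset.range (n + 1), θ ^ l * w (n - l)

lemma geomConv_succ (θ : ℝ) (w : ℕ → ℝ) (n : ℕ) :
    geomConv θ w (n + 1) = θ * geomConv θ w n + w (n + 1) := by
  unfold geomConv
  rw [Finset.sum_range_succ', Finset.mul_sum]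
  congr 1
  · refine Finset.sum_congr rfl fun l _ => ?_
    rw [Nat.add_sub_add_right]
    ring
  · simp

lemma geomConv_add_le {θ : ℝ} (h0 : 0 ≤ θ) (h1 : θ < 1) {w : ℕ → ℝ} (hw : Antitone w)
    (k l : ℕ) :
    geomConv θ w (k + l) ≤ θ ^ l * geomConv θ w k + w k * ((1 - θ ^ l) / (1 - θ)) := by
  induction l with
  | zero => simp
  | succ l ih =>
    rw [← add_assoc, geomConv_succ]
    have h2 : w (k + l + 1) ≤ w k := hw (by omega)
    have h3 : (1 - θ) ≠ 0 := by linarith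
    have h4 := mul_le_mul_of_nonneg_left ih h0
    have h5 : θ ^ (l + 1) * geomConv θ w k + w k * ((1 - θ ^ (l + 1)) / (1 - θ)) =
        θ * (θ ^ l * geomConv θ w k + w k * ((1 - θ ^ l) / (1 - θ))) + w k := by
      field_simp
      ring
    linarith

/-- The geometrically weighted sum of the majorant in `geomConv_add_le`. -/
lemma hasSum_geom_majorant {θ : ℝ} (h0 : 0 ≤ θ) (h1 : θ < 1) (v u : ℝ) :
    HasSum (fun l : ℕ => θ ^ l * (θ ^ l * v + u * ((1 - θ ^ l) / (1 - θ))))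
      ((v + u * (θ / (1 - θ))) / (1 - θ ^ 2)) := by
  have hsq : θ ^ 2 < 1 := pow_lt_one₀ h0 h1 two_ne_zero
  have h2 := (hasSum_geometric_of_lt_one (sq_nonneg θ) hsq).mul_left (v - u / (1 - θ))
  have h3 := (hasSum_geometric_of_lt_one h0 h1).mul_left (u / (1 - θ))
  have h4 : (1 - θ) ≠ 0 := by linarith
  have h6 : (1 + θ) ≠ 0 := by linarith
  have hval : (v + u * (θ / (1 - θ))) / (1 - θ ^ 2) =
      (v - u / (1 - θ)) * (1 - θ ^ 2)⁻¹ + u / (1 - θ) * (1 - θ)⁻¹ := by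
    have h7 : 1 - θ ^ 2 = (1 - θ) * (1 + θ) := by ring
    rw [h7]
    field_simp
    ring
  have hfun : (fun l : ℕ => θ ^ l * (θ ^ l * v + u * ((1 - θ ^ l) / (1 - θ)))) =
      fun l : ℕ => (v - u / (1 - θ)) * (θ ^ 2) ^ l + u / (1 - θ) * θ ^ l := by
    funext l
    field_simp
    ring
  rw [hfun, hval]
  exact h2.add h3

section Determinants

variable {δ γ : ℝ} {a b c d : ℕ → ℝ}

lemma mul_abs_le_abs_det_succ (hγ1 : γ ≤ 1) (hδ : δ ^ 2 = γ * (1 - γ))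
    (hδ0 : 0 ≤ δ)
    (ha : ∀ n, 2 ≤ n → |a n| ≤ δ * |b n|) (hc : ∀ n, 1 ≤ n → |c n| ≤ δ * |b n|)
    (hd0 : d 0 = 1) (hd1 : d 1 = b 1)
    (hd : ∀ n : ℕ, d (n + 2) = b (n + 2) * d (n + 1) - a (n + 2) * c (n + 1) * d n) (n : ℕ) :
    γ * |b (n + 1)| * |d n| ≤ |d (n + 1)| := by
  induction n with
  | zero =>
    rw [hd0, hd1, abs_one, mul_one]
    exact mul_le_of_le_one_left (abs_nonneg _) hγ1
  | succ n ih =>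
    rw [hd n]
    have h1 : |a (n + 2) * c (n + 1) * d n| ≤ (1 - γ) * |b (n + 2)| * |d (n + 1)| := by
      rw [abs_mul, abs_mul]
      calc |a (n + 2)| * |c (n + 1)| * |d n|
          ≤ (δ * |b (n + 2)|) * (δ * |b (n + 1)|) * |d n| := by
            gcongr
            · exact ha _ (by omega)
            · exact hc _ (by omega)
        _ = (1 - γ) * |b (n + 2)| * (γ * |b (n + 1)| * |d n|) := by
            linear_combination |b (n + 2)| * |b (n + 1)| * |d n| * hδ
        _ ≤ _ := by
            have : 0 ≤ 1 - γ := by linarith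
            gcongr
    have h2 := abs_sub_abs_le_abs_sub (b (n + 2) * d (n + 1)) (a (n + 2) * c (n + 1) * d n)
    rw [abs_mul (b (n + 2))] at h2
    show γ * |b (n + 2)| * |d (n + 1)| ≤ _
    linarith

lemma abs_lower_coeff_le {θ : ℝ} (hθ : 0 ≤ θ) (hδ : δ = θ * γ)
    (ha : ∀ n, 2 ≤ n → |a n| ≤ δ * |b n|)
    (hdet : ∀ n, γ * |b (n + 1)| * |d n| ≤ |d (n + 1)|) (l j : ℕ) :
    (∏ i ∈ Finset.range l, |a (j + l + 1 - i)|) * |d j| * |b (j + 1)| ≤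
      θ ^ l * |b (j + l + 1)| * |d (j + l)| := by
  induction l generalizing j with
  | zero => simp [mul_comm]
  | succ l ih =>
    have h1 := ih (j + 1)
    have e1 : j + 1 + l = j + (l + 1) := by omega
    rw [e1] at h1
    rw [Finset.prod_range_succ]
    have e2 : j + (l + 1) + 1 - l = j + 2 := by omega
    rw [e2]
    have hP : 0 ≤ ∏ i ∈ Finset.range l, |a (j + (l + 1) + 1 - i)| :=
      Finset.prod_nonneg fun _ _ => abs_nonneg _
    generalize (∏ i ∈ Finset.range l, |a (j + (l + 1) + 1 - i)|) = P at *
    calc P * |a (j + 2)| * |d j| * |b (j + 1)|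
        ≤ P * (δ * |b (j + 2)|) * |d j| * |b (j + 1)| := by
          gcongr
          exact ha _ (by omega)
      _ = θ * P * |b (j + 2)| * (γ * |b (j + 1)| * |d j|) := by rw [hδ]; ring
      _ ≤ θ * P * |b (j + 2)| * |d (j + 1)| := by
          gcongr
          exact hdet j
      _ = θ * (P * |d (j + 1)| * |b (j + 1 + 1)|) := by ring
      _ ≤ θ * (θ ^ l * |b (j + (l + 1) + 1)| * |d (j + (l + 1))|) := by gcongr
      _ = _ := by ring

lemma abs_upper_coeff_le {θ : ℝ} (hγ0 : 0 < γ) (hθ : 0 ≤ θ) (hδ : δ = θ * γ)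
    (hc : ∀ n, 1 ≤ n → |c n| ≤ δ * |b n|)
    (hdet : ∀ n, γ * |b (n + 1)| * |d n| ≤ |d (n + 1)|) (k l : ℕ) :
    |d k| * (∏ i ∈ Finset.range l, |c (k + 1 + i)|) * |b (k + l + 1)| * γ ≤
      θ ^ l * |d (k + l + 1)| := by
  induction l with
  | zero => simpa [mul_comm, mul_left_comm, mul_assoc] using hdet k
  | succ l ih =>
    rw [Finset.prod_range_succ]
    have hP : 0 ≤ ∏ i ∈ Finset.range l, |c (k + 1 + i)| :=
      Finset.prod_nonneg fun _ _ => abs_nonneg _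
    generalize (∏ i ∈ Finset.range l, |c (k + 1 + i)|) = P at *
    have e1 : k + 1 + l = k + l + 1 := by omega
    have e2 : k + (l + 1) + 1 = k + l + 2 := by omega
    rw [e1, e2]
    calc |d k| * (P * |c (k + l + 1)|) * |b (k + l + 2)| * γ
        ≤ |d k| * (P * (δ * |b (k + l + 1)|)) * |b (k + l + 2)| * γ := by
          gcongr
          exact hc _ (by omega)
      _ = θ * γ * |b (k + l + 2)| * (|d k| * P * |b (k + l + 1)| * γ) := by rw [hδ]; ring
      _ ≤ θ * γ * |b (k + l + 2)| * (θ ^ l * |d (k + l + 1)|) := by gcongr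
      _ = θ ^ (l + 1) * (γ * |b (k + l + 1 + 1)| * |d (k + l + 1)|) := by ring
      _ ≤ θ ^ (l + 1) * |d (k + l + 2)| := by
          gcongr
          exact hdet (k + l + 1)

lemma abs_forward_solution_le {θ K : ℝ} {w y z : ℕ → ℝ} (hθ : 0 ≤ θ)
    (hδ : δ = θ * γ) (hb : ∀ n, 1 ≤ n → b n ≠ 0) (hdn : ∀ n, d n ≠ 0)
    (ha : ∀ n, 2 ≤ n → |a n| ≤ δ * |b n|)
    (hdet : ∀ n, γ * |b (n + 1)| * |d n| ≤ |d (n + 1)|)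
    (hz0 : z 0 = y 0)
    (hzk : ∀ k, 1 ≤ k → z k = y k + ∑ l ∈ Finset.Icc 1 k,
      (-1 : ℝ) ^ l * (∏ i ∈ Finset.range l, a (k + 1 - i)) * (d (k - l) / d k) * y (k - l))
    (hy : ∀ n, |y n| ≤ K * w n * |b (n + 1)|) (k : ℕ) :
    |z k| ≤ K * geomConv θ w k * |b (k + 1)| := by
  have hz : z k = ∑ l ∈ Finset.range (k + 1),
      (-1 : ℝ) ^ l * (∏ i ∈ Finset.range l, a (k + 1 - i)) * (d (k - l) / d k) * y (k - l) := by
    rcases Nat.eq_zero_or_pos k with rfl | hk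
    · simp [hz0, div_self (hdn 0)]
    · rw [hzk k hk, Finset.range_eq_Ico, Finset.sum_eq_sum_Ico_succ_bot (by omega)]
      simp only [pow_zero, Finset.range_zero, Finset.prod_empty, Nat.sub_zero, div_self (hdn k),
        one_mul]
      rfl
  rw [hz, geomConv, Finset.mul_sum, Finset.sum_mul]
  refine (Finset.abs_sum_le_sum_abs _ _).trans (Finset.sum_le_sum fun l hl => ?_)
  obtain ⟨j, rfl⟩ : ∃ j, k = j + l := ⟨k - l, by have := Finset.mem_range.1 hl; omega⟩
  rw [Nat.add_sub_cancel]
  have h1 := abs_lower_coeff_le hθ hδ ha hdet l j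
  rw [abs_mul, abs_mul, abs_mul, abs_pow, abs_neg, abs_one, one_pow, one_mul, Finset.abs_prod,
    abs_div]
  have hP : 0 ≤ ∏ i ∈ Finset.range l, |a (j + l + 1 - i)| :=
    Finset.prod_nonneg fun _ _ => abs_nonneg _
  generalize (∏ i ∈ Finset.range l, |a (j + l + 1 - i)|) = P at *
  have hdp : 0 < |d (j + l)| := abs_pos.2 (hdn _)
  have hbp : 0 < |b (j + 1)| := abs_pos.2 (hb _ (by omega))
  have hKw : 0 ≤ K * w j := by
    have := (abs_nonneg _).trans (hy j)
    exact nonneg_of_mul_nonneg_left this hbp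
  calc P * (|d j| / |d (j + l)|) * |y j|
      ≤ P * (|d j| / |d (j + l)|) * (K * w j * |b (j + 1)|) := by
        gcongr
        exact hy j
    _ = (P * |d j| * |b (j + 1)|) / |d (j + l)| * (K * w j) := by ring
    _ ≤ (θ ^ l * |b (j + l + 1)| * |d (j + l)|) / |d (j + l)| * (K * w j) := by gcongr
    _ = _ := by field_simp

lemma abs_Uterm_le {θ : ℝ} {z : ℕ → ℝ} (hγ0 : 0 < γ) (hθ : 0 ≤ θ)
    (hδ : δ = θ * γ) (hb : ∀ n, 1 ≤ n → b n ≠ 0) (hdn : ∀ n, d n ≠ 0)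
    (hc : ∀ n, 1 ≤ n → |c n| ≤ δ * |b n|)
    (hdet : ∀ n, γ * |b (n + 1)| * |d n| ≤ |d (n + 1)|) {V : ℝ} (k l : ℕ)
    (hz : |z (k + l)| ≤ V * |b (k + l + 1)|) :
    |Uterm c d z k l| ≤ θ ^ l * V / γ := by
  have h1 := abs_upper_coeff_le hγ0 hθ hδ hc hdet k l
  rw [Uterm, abs_mul, abs_mul, abs_mul, abs_pow, abs_neg, abs_one, one_pow, one_mul,
    Finset.abs_prod, abs_div]
  have hP : 0 ≤ ∏ i ∈ Finset.range l, |c (k + 1 + i)| :=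
    Finset.prod_nonneg fun _ _ => abs_nonneg _
  generalize (∏ i ∈ Finset.range l, |c (k + 1 + i)|) = P at *
  have hdp : 0 < |d (k + l + 1)| := abs_pos.2 (hdn _)
  have hbp : 0 < |b (k + l + 1)| := abs_pos.2 (hb _ (by omega))
  have hV : 0 ≤ V := nonneg_of_mul_nonneg_left ((abs_nonneg _).trans hz) hbp
  calc |d k| / |d (k + l + 1)| * P * |z (k + l)|
      ≤ |d k| / |d (k + l + 1)| * P * (V * |b (k + l + 1)|) := by gcongr
    _ = (|d k| * P * |b (k + l + 1)| * γ) / |d (k + l + 1)| * (V / γ) := by field_simp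
    _ ≤ (θ ^ l * |d (k + l + 1)|) / |d (k + l + 1)| * (V / γ) := by gcongr
    _ = _ := by field_simp

lemma abs_Uinv_le {θ K : ℝ} {w z : ℕ → ℝ} (hγ0 : 0 < γ) (hθ : 0 ≤ θ) (hθ1 : θ < 1)
    (hδ : δ = θ * γ) (hb : ∀ n, 1 ≤ n → b n ≠ 0) (hdn : ∀ n, d n ≠ 0)
    (hc : ∀ n, 1 ≤ n → |c n| ≤ δ * |b n|)
    (hdet : ∀ n, γ * |b (n + 1)| * |d n| ≤ |d (n + 1)|) (hK : 0 ≤ K) (hw : Antitone w)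
    (hz : ∀ n, |z n| ≤ K * geomConv θ w n * |b (n + 1)|) (k : ℕ) :
    |Uinv c d z k| ≤
      K / γ * ((geomConv θ w k + w k * (θ / (1 - θ))) / (1 - θ ^ 2)) := by
  set g : ℕ → ℝ := fun l => K / γ *
    (θ ^ l * (θ ^ l * geomConv θ w k + w k * ((1 - θ ^ l) / (1 - θ)))) with hg
  have hsum : HasSum g _ := (hasSum_geom_majorant hθ hθ1 (geomConv θ w k) (w k)).mul_left (K / γ)
  have hterm : ∀ l, |Uterm c d z k l| ≤ g l := fun l => by
    refine (abs_Uterm_le hγ0 hθ hδ hb hdn hc hdet k l (hz (k + l))).trans ?_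
    have := geomConv_add_le hθ hθ1 hw k l
    calc θ ^ l * (K * geomConv θ w (k + l)) / γ
        = K / γ * (θ ^ l * geomConv θ w (k + l)) := by ring
      _ ≤ _ := by
          simp only [hg]
          gcongr
  have htail := (hasSum_nat_add_iff' 1).2 hsum
  have h1 := tsum_of_norm_bounded htail
    (f := fun l => Uterm c d z k (l + 1)) fun l => hterm (l + 1)
  have h0 := hterm 0
  have hU0 : Uterm c d z k 0 = d k / d (k + 1) * z k := by simp [Uterm]
  rw [hU0] at h0
  rw [Real.norm_eq_abs, Finset.sum_range_one] at h1
  unfold Uinv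
  refine (abs_add_le _ _).trans ?_
  linarith

end Determinants

/-- A quadratic with negative leading coefficient is nonpositive beyond its larger root. -/
lemma quadratic_nonpos_of_root_le {L B m M : ℝ} (hL : L < 0) (hm : 0 ≤ m)
    (hM : (-B - Real.sqrt (B ^ 2 - 4 * m * L)) / (2 * L) ≤ M) :
    L * M ^ 2 + B * M + m ≤ 0 := by
  have h1 : M * (2 * L) ≤ -B - Real.sqrt (B ^ 2 - 4 * m * L) :=
    (div_le_iff_of_neg (by linarith)).1 hM
  have hD : 0 ≤ B ^ 2 - 4 * m * L := by nlinarith [sq_nonneg B]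
  have h2 := Real.sq_sqrt hD
  have h3 := Real.sqrt_nonneg (B ^ 2 - 4 * m * L)
  have h4 : B ^ 2 - 4 * m * L ≤ (2 * L * M + B) ^ 2 := by nlinarith
  by_contra! h
  nlinarith [mul_neg_of_neg_of_pos hL h]

lemma le_mul_exp_of_pos {x y : ℝ} (hx : 0 < x) : y ≤ x * Real.exp ((y - x) / x) := by
  have h := Real.add_one_le_exp ((y - x) / x)
  calc y = x * ((y - x) / x + 1) := by field_simp; ring
    _ ≤ _ := by gcongr

lemma rpow_half_mul_le {θ m p M k : ℝ} (hθ : 0 < θ) (hm : 0 < m) (hp : 0 ≤ p) (hM : 0 < M)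
    (hMk : M ≤ k)
    (hq : Real.log θ / 2 * M ^ 2 + (m * (Real.log θ / 2) + p + 1) * M + m ≤ 0) :
    θ ^ (k / 2) * (k / 2) * ((m + k) / m) ^ p ≤
      θ ^ (M / 2) * (M / 2) * ((m + M) / m) ^ p := by
  have hk : 0 < k := hM.trans_le hMk
  have h1 : k ≤ M * Real.exp ((k - M) / M) := le_mul_exp_of_pos hM
  have h2 : (m + k) / m ≤ (m + M) / m * Real.exp ((k - M) / (m + M)) := by
    have := le_mul_exp_of_pos (x := m + M) (y := m + k) (by positivity)
    rw [add_sub_add_left_eq_sub] at this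
    calc (m + k) / m ≤ ((m + M) * Real.exp ((k - M) / (m + M))) / m := by gcongr
      _ = _ := by ring
  have h3 : ((m + k) / m) ^ p ≤ ((m + M) / m) ^ p * Real.exp ((k - M) / (m + M) * p) := by
    rw [Real.exp_mul, ← Real.mul_rpow (by positivity) (by positivity)]
    gcongr
  have h4 : Real.log θ / 2 + 1 / M + p / (m + M) ≤ 0 := by
    have : Real.log θ / 2 + 1 / M + p / (m + M) =
        (Real.log θ / 2 * M ^ 2 + (m * (Real.log θ / 2) + p + 1) * M + m) / (M * (m + M)) := by
      have : m + M ≠ 0 := by positivity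
      field_simp
      ring
    rw [this]
    exact div_nonpos_of_nonpos_of_nonneg hq (by positivity)
  have h5 : θ ^ (k / 2) = θ ^ (M / 2) * Real.exp ((k - M) * (Real.log θ / 2)) := by
    rw [Real.rpow_def_of_pos hθ, Real.rpow_def_of_pos hθ, ← Real.exp_add]
    congr 1
    ring
  rw [h5]
  calc θ ^ (M / 2) * Real.exp ((k - M) * (Real.log θ / 2)) * (k / 2) * ((m + k) / m) ^ p
      ≤ θ ^ (M / 2) * Real.exp ((k - M) * (Real.log θ / 2)) *
          (M * Real.exp ((k - M) / M) / 2) *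
          (((m + M) / m) ^ p * Real.exp ((k - M) / (m + M) * p)) := by gcongr
    _ = θ ^ (M / 2) * (M / 2) * ((m + M) / m) ^ p *
          Real.exp ((k - M) * (Real.log θ / 2 + 1 / M + p / (m + M))) := by
        have : (k - M) * (Real.log θ / 2 + 1 / M + p / (m + M)) =
          (k - M) * (Real.log θ / 2) + (k - M) / M + (k - M) / (m + M) * p := by ring
        rw [this, Real.exp_add, Real.exp_add]
        ring
    _ ≤ θ ^ (M / 2) * (M / 2) * ((m + M) / m) ^ p * 1 := by
        gcongr
        rw [Real.exp_le_one_iff]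
        exact mul_nonpos_of_nonneg_of_nonpos (by linarith) h4
    _ = _ := mul_one _

lemma rpow_sqrt_mul_le {θ M k : ℝ} (hθ : 0 < θ) (hθ1 : θ < 1) (hM : 0 < M) (hMk : M ≤ k)
    (hq : 4 / Real.log θ ^ 2 ≤ M) :
    θ ^ Real.sqrt k * (k / 2) ≤ θ ^ Real.sqrt M * (M / 2) := by
  have hlog : Real.log θ < 0 := Real.log_neg hθ hθ1
  have hk : 0 < k := hM.trans_le hMk
  have hv : 0 < Real.sqrt M := Real.sqrt_pos.2 hM
  have huv : Real.sqrt M ≤ Real.sqrt k := Real.sqrt_le_sqrt hMk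
  have hv2 : Real.sqrt M ^ 2 = M := Real.sq_sqrt hM.le
  have hu2 : Real.sqrt k ^ 2 = k := Real.sq_sqrt hk.le
  generalize Real.sqrt M = v at *
  generalize Real.sqrt k = u at *
  subst hv2 hu2
  have h1 : 2 ≤ -Real.log θ * v := by
    rw [div_le_iff₀ (sq_pos_of_neg hlog)] at hq
    nlinarith [mul_pos_of_neg_of_neg hlog (neg_lt_zero.2 hv)]
  have h2 : u ≤ v * Real.exp ((u - v) / v) := le_mul_exp_of_pos hv
  have h3 : θ ^ u = θ ^ v * Real.exp ((u - v) * Real.log θ) := by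
    rw [Real.rpow_def_of_pos hθ, Real.rpow_def_of_pos hθ, ← Real.exp_add]
    congr 1
    ring
  have hu : 0 < u := hv.trans_le huv
  rw [h3]
  calc θ ^ v * Real.exp ((u - v) * Real.log θ) * (u ^ 2 / 2)
      ≤ θ ^ v * Real.exp ((u - v) * Real.log θ) * ((v * Real.exp ((u - v) / v)) ^ 2 / 2) := by
        gcongr
    _ = θ ^ v * (v ^ 2 / 2) * Real.exp ((u - v) * (Real.log θ + 2 / v)) := by
        have : (u - v) * (Real.log θ + 2 / v) =
          (u - v) * Real.log θ + (u - v) / v + (u - v) / v := by ring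
        rw [this, Real.exp_add, Real.exp_add]
        ring
    _ ≤ θ ^ v * (v ^ 2 / 2) * 1 := by
        gcongr
        rw [Real.exp_le_one_iff]
        refine mul_nonpos_of_nonneg_of_nonpos (by linarith) ?_
        have : 2 / v ≤ -Real.log θ := by rwa [div_le_iff₀ hv]
        linarith
    _ = _ := mul_one _

lemma sub_sqrt_sub_one_pos {m x : ℝ} (hm : 2 ≤ m) (hx : 0 ≤ x) : 0 < m + x - Real.sqrt x - 1 := by
  have := Real.sq_sqrt hx
  nlinarith [sq_nonneg (Real.sqrt x - 1 / 2)]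

lemma div_sub_sqrt_le {m M k : ℝ} (hm : 2 ≤ m) (hmM : m ≤ M) (hMk : M ≤ k) :
    (m + k) / (m + k - Real.sqrt k - 1) ≤ (m + M) / (m + M - Real.sqrt M - 1) := by
  have hM : 0 ≤ M := by linarith
  have hk : 0 ≤ k := by linarith
  rw [div_le_div_iff₀ (sub_sqrt_sub_one_pos hm hk) (sub_sqrt_sub_one_pos hm hM)]
  have huv : Real.sqrt M ≤ Real.sqrt k := Real.sqrt_le_sqrt hMk
  have hv2 := Real.sq_sqrt hM
  have hu2 := Real.sq_sqrt hk
  have hv := Real.sqrt_nonneg M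
  generalize Real.sqrt M = v at *
  generalize Real.sqrt k = u at *
  subst hv2 hu2
  have h1 : 0 ≤ u * v + u + v - m := by nlinarith
  nlinarith [mul_nonneg (sub_nonneg.2 huv) h1]

/-- Splitting of the geometric average of `((m + k) / (m + k - l)) ^ p` at `⌈√k⌉` and `⌈k / 2⌉`. -/
lemma sum_geom_mul_ratio_rpow_le {θ m p : ℝ} (hθ : 0 < θ) (hθ1 : θ < 1) (hm : 2 ≤ m) (hp : 0 ≤ p)
    (k : ℕ) :
    ∑ l ∈ Finset.range (k + 1), θ ^ l * ((m + k) / (m + (k - l : ℕ))) ^ p ≤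
      θ ^ ((k : ℝ) / 2) * ((k : ℝ) / 2) * ((m + k) / m) ^ p +
        θ ^ Real.sqrt k * ((k : ℝ) / 2) * (2 : ℝ) ^ p +
        1 / (1 - θ) * ((m + k) / (m + k - Real.sqrt k - 1)) ^ p := by
  set A := θ ^ ((k : ℝ) / 2) * ((m + k) / m) ^ p with hA
  set B := θ ^ Real.sqrt k * (2 : ℝ) ^ p with hB
  set C := ((m + k) / (m + k - Real.sqrt k - 1)) ^ p with hC
  have hden := sub_sqrt_sub_one_pos hm (Nat.cast_nonneg (α := ℝ) k)
  have hA0 : 0 ≤ A := by positivity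
  have hB0 : 0 ≤ B := by positivity
  have hC0 : 0 ≤ C := by positivity
  set h := (k + 1) / 2 with hh
  have hbound : ∀ l ∈ Finset.range (k + 1), θ ^ l * ((m + k) / (m + (k - l : ℕ))) ^ p ≤
      (if h < l then A else 0) + (if 2 ≤ l ∧ l ≤ h then B else 0) + θ ^ l * C := by
    intro l hl
    have hlk : l ≤ k := Nat.lt_succ_iff.1 (Finset.mem_range.1 hl)
    have hlc : (l : ℝ) ≤ k := by exact_mod_cast hlk
    rw [Nat.cast_sub hlk]
    have hpos : 0 < m + ((k : ℝ) - l) := by linarith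
    have hθlC : 0 ≤ θ ^ l * C := by positivity
    by_cases h1 : (l : ℝ) ≤ Real.sqrt k + 1
    · have : θ ^ l * ((m + k) / (m + ((k : ℝ) - l))) ^ p ≤ θ ^ l * C := by
        rw [hC]
        gcongr θ ^ l * ((m + k) / ?_) ^ p
        linarith
      have h2 : 0 ≤ (if h < l then A else 0) := by split_ifs <;> simp [hA0]
      have h3 : 0 ≤ (if 2 ≤ l ∧ l ≤ h then B else 0) := by split_ifs <;> simp [hB0]
      linarith
    · push Not at h1
      have hsq := Real.sqrt_nonneg (k : ℝ)
      by_cases h2 : h < l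
      · have h3 : ¬ (2 ≤ l ∧ l ≤ h) := by omega
        rw [if_pos h2, if_neg h3, add_zero]
        have h4 : (k : ℝ) / 2 ≤ l := by
          have : k ≤ 2 * l := by omega
          have : (k : ℝ) ≤ 2 * l := by exact_mod_cast this
          linarith
        have : θ ^ l * ((m + k) / (m + ((k : ℝ) - l))) ^ p ≤ A := by
          rw [hA, ← Real.rpow_natCast θ l]
          gcongr ?_ * ((m + k) / ?_) ^ p
          · exact Real.rpow_le_rpow_of_exponent_ge hθ hθ1.le h4
          · linarith
        linarith
      · have h3 : 2 ≤ l ∧ l ≤ h := by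
          refine ⟨?_, by omega⟩
          have : (1 : ℝ) < l := by linarith
          exact_mod_cast this
        rw [if_neg h2, if_pos h3, zero_add]
        have h4 : 2 * (l : ℝ) ≤ k + 1 := by
          have : 2 * l ≤ k + 1 := by omega
          exact_mod_cast this
        have : θ ^ l * ((m + k) / (m + ((k : ℝ) - l))) ^ p ≤ B := by
          rw [hB, ← Real.rpow_natCast θ l]
          refine mul_le_mul ?_ ?_ (by positivity) (by positivity)
          · exact Real.rpow_le_rpow_of_exponent_ge hθ hθ1.le (by linarith)
          · refine Real.rpow_le_rpow (by positivity) ?_ hp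
            rw [div_le_iff₀ hpos]
            linarith
        linarith
  refine (Finset.sum_le_sum hbound).trans ?_
  rw [Finset.sum_add_distrib, Finset.sum_add_distrib, ← Finset.sum_mul]
  have hsA : ∑ l ∈ Finset.range (k + 1), (if h < l then A else 0) ≤ (k : ℝ) / 2 * A := by
    rw [← Finset.sum_filter, Finset.sum_const, nsmul_eq_mul]
    have e : (Finset.range (k + 1)).filter (fun l => h < l) = Finset.Ioc h k := by
      ext l
      simp only [Finset.mem_filter, Finset.mem_range, Finset.mem_Ioc]
      omega
    have hcard : 2 * (k - h) ≤ k := by omega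
    have hcard' : 2 * ((k - h : ℕ) : ℝ) ≤ k := by exact_mod_cast hcard
    rw [e, Nat.card_Ioc]
    gcongr
    linarith
  have hsB : ∑ l ∈ Finset.range (k + 1), (if 2 ≤ l ∧ l ≤ h then B else 0) ≤
      (k : ℝ) / 2 * B := by
    rw [← Finset.sum_filter, Finset.sum_const, nsmul_eq_mul]
    have e : (Finset.range (k + 1)).filter (fun l => 2 ≤ l ∧ l ≤ h) ⊆
        Finset.Icc 2 h := by
      intro l
      simp only [Finset.mem_filter, Finset.mem_Icc]
      omega
    have hcard := Finset.card_le_card e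
    rw [Nat.card_Icc] at hcard
    have hcard2 : 2 * ((Finset.range (k + 1)).filter
        (fun l => 2 ≤ l ∧ l ≤ h)).card ≤ k := by omega
    have hcard' : 2 * (((Finset.range (k + 1)).filter
        (fun l => 2 ≤ l ∧ l ≤ h)).card : ℝ) ≤ k := by exact_mod_cast hcard2
    gcongr
    linarith
  have hsC : ∑ l ∈ Finset.range (k + 1), θ ^ l ≤ 1 / (1 - θ) := by
    rw [one_div, ← tsum_geometric_of_lt_one hθ.le hθ1]
    exact (summable_geometric_of_lt_one hθ.le hθ1).sum_le_tsum _ fun _ _ => by positivity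
  have hsC' := mul_le_mul_of_nonneg_right hsC hC0
  linarith

/-- the uniform tail bound. If `m ≥ 2`,
`Y_s := sup_{k≥0} |y_k| (m+k)^s < ∞` (`s > 1`), and the integer `M` satisfies the lower
bound `M ≥ max(…)`, then with
`χ = θ^{M/2} (M/2) ((m+M)/m)^{s+s_L} + θ^{√M} (M/2) 2^{s+s_L}
+ (1/(1−θ)) ((m+M)/(m+M−√M−1))^{s+s_L}`,
for every `k ≥ M` one has `|(G y)_k| (m+k)^{s+s_L} ≤ (η Y_s / C₁)(χ + θ/(1−θ))`. -/
theorem statement11 (δ : ℝ) (hδ0 : 0 < δ) (hδ1 : δ < 1 / 2)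
    (a b c : ℕ → ℝ)
    (hb : ∀ n, 1 ≤ n → b n ≠ 0)
    (ha : ∀ n, 2 ≤ n → |a n| ≤ δ * |b n|)
    (hc : ∀ n, 1 ≤ n → |c n| ≤ δ * |b n|)
    (d : ℕ → ℝ)
    (hd0 : d 0 = 1) (hd1 : d 1 = b 1)
    (hd : ∀ n : ℕ, d (n + 2) = b (n + 2) * d (n + 1) - a (n + 2) * c (n + 1) * d n)
    (γ θ η : ℝ) (hγ : γ = 1 / 2 + Real.sqrt (1 / 4 - δ ^ 2)) (hθ : θ = δ / γ)
    (hη : η = 1 / (γ * (1 - θ ^ 2)))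
    (m : ℕ) (hm : 2 ≤ m) (sL C₁ : ℝ) (hsL : 0 < sL) (hC₁ : 0 < C₁)
    (hblow : ∀ k : ℕ, C₁ * ((m : ℝ) + k) ^ sL ≤ |b (k + 1)|)
    (y z : ℕ → ℝ)
    (hz0 : z 0 = y 0)
    (hzk : ∀ k, 1 ≤ k → z k = y k + ∑ l ∈ Finset.Icc 1 k,
      (-1 : ℝ) ^ l * (∏ i ∈ Finset.range l, a (k + 1 - i)) * (d (k - l) / d k) * y (k - l))
    (s : ℝ) (hs : 1 < s)
    (hy : BddAbove (Set.range fun k => |y k| * ((m : ℝ) + k) ^ s))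
    (M : ℕ)
    (hM : (M : ℝ) ≥ max (max
      ((-(m : ℝ) * Real.log (Real.sqrt θ) - s - sL - 1 -
          Real.sqrt (((m : ℝ) * Real.log (Real.sqrt θ) + s + sL + 1) ^ 2 -
            4 * (m : ℝ) * Real.log (Real.sqrt θ))) / (2 * Real.log (Real.sqrt θ)))
      (4 / (Real.log θ) ^ 2)) (m : ℝ)) :
    ∀ k : ℕ, M ≤ k →
      |Uinv c d z k| * ((m : ℝ) + k) ^ (s + sL) ≤
        η * (⨆ j : ℕ, |y j| * ((m : ℝ) + j) ^ s) / C₁ *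
          ((θ ^ ((M : ℝ) / 2) * ((M : ℝ) / 2) * (((m : ℝ) + M) / m) ^ (s + sL) +
            θ ^ Real.sqrt M * ((M : ℝ) / 2) * (2 : ℝ) ^ (s + sL) +
            1 / (1 - θ) *
              (((m : ℝ) + M) / ((m : ℝ) + M - Real.sqrt M - 1)) ^ (s + sL)) +
          θ / (1 - θ)) := by
  have hsq0 : 0 ≤ 1 / 4 - δ ^ 2 := by nlinarith
  have hsqrt := Real.sq_sqrt hsq0
  have hsqrt0 := Real.sqrt_nonneg (1 / 4 - δ ^ 2)
  have hγ0 : 1 / 2 ≤ γ := by linarith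
  have hγpos : 0 < γ := by linarith
  have hγδ : δ ^ 2 = γ * (1 - γ) := by
    rw [hγ]
    linear_combination hsqrt
  have hγ1 : γ ≤ 1 := by
    by_contra! h
    nlinarith [mul_pos hγpos (sub_pos.2 h), sq_nonneg δ]
  have hθ0 : 0 < θ := hθ ▸ div_pos hδ0 hγpos
  have hθ1 : θ < 1 := by
    rw [hθ, div_lt_one hγpos]
    linarith
  have hδθ : δ = θ * γ := by
    rw [hθ]
    field_simp
  have hdet := mul_abs_le_abs_det_succ hγ1 hγδ hδ0.le ha hc hd0 hd1 hd
  have hdn : ∀ n, d n ≠ 0 := by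
    intro n
    induction n with
    | zero => rw [hd0]; exact one_ne_zero
    | succ n ih =>
      have hbn := abs_pos.2 (hb (n + 1) (by omega))
      have hdp := abs_pos.2 ih
      exact abs_pos.1 ((by positivity : 0 < γ * |b (n + 1)| * |d n|).trans_le (hdet n))
  set Y := ⨆ j : ℕ, |y j| * ((m : ℝ) + j) ^ s with hY
  have hm2 : (2 : ℝ) ≤ m := by exact_mod_cast hm
  have hp : 0 < s + sL := by linarith
  set p := s + sL with hpdef
  set w : ℕ → ℝ := fun n => 1 / ((m : ℝ) + n) ^ p with hw
  have hw_anti : Antitone w := by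
    intro i j hij
    simp only [hw]
    gcongr
  have hY0 : 0 ≤ Y := Real.iSup_nonneg fun j => by positivity
  have hyw : ∀ n, |y n| ≤ Y / C₁ * w n * |b (n + 1)| := by
    intro n
    have h1 : |y n| * ((m : ℝ) + n) ^ s ≤ Y := le_ciSup hy n
    have h2 := hblow n
    have hmn : (0 : ℝ) < m + n := by positivity
    have hs0 : 0 < ((m : ℝ) + n) ^ s := by positivity
    have hsL0 : 0 < ((m : ℝ) + n) ^ sL := by positivity
    simp only [hw, hpdef]
    rw [Real.rpow_add hmn]
    calc |y n| ≤ Y / ((m : ℝ) + n) ^ s := (le_div_iff₀ hs0).2 h1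
      _ = Y / C₁ * (1 / (((m : ℝ) + n) ^ s * ((m : ℝ) + n) ^ sL)) *
          (C₁ * ((m : ℝ) + n) ^ sL) := by field_simp
      _ ≤ _ := by gcongr
  have hz := abs_forward_solution_le hθ0.le hδθ hb hdn ha hdet hz0 hzk hyw
  have hK : 0 ≤ Y / C₁ := by positivity
  have hlog : Real.log (Real.sqrt θ) = Real.log θ / 2 := Real.log_sqrt hθ0.le
  have hlogneg : Real.log θ < 0 := Real.log_neg hθ0 hθ1
  rw [hlog] at hM
  have hMm : (m : ℝ) ≤ M := (le_max_right _ _).trans hM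
  have hM4 : 4 / Real.log θ ^ 2 ≤ (M : ℝ) :=
    ((le_max_right _ _).trans (le_max_left _ _)).trans hM
  have hMq := ((le_max_left _ _).trans (le_max_left _ _)).trans hM
  have hquad : Real.log θ / 2 * (M : ℝ) ^ 2 + (m * (Real.log θ / 2) + p + 1) * M + m ≤ 0 := by
    refine quadratic_nonpos_of_root_le (by linarith) (by linarith) (le_trans (le_of_eq ?_) hMq)
    simp only [hpdef, neg_mul]
    ring_nf
  intro k hk
  have hMk : (M : ℝ) ≤ k := by exact_mod_cast hk
  have hMpos : (0 : ℝ) < M := by linarith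
  have hmpos : (0 : ℝ) < m := by linarith
  have hU := abs_Uinv_le hγpos hθ0.le hθ1 hδθ hb hdn hc hdet hK hw_anti hz k
  have hmk : (0 : ℝ) < m + k := by positivity
  have hmkp : (0 : ℝ) < ((m : ℝ) + k) ^ p := by positivity
  have hwk : w k * ((m : ℝ) + k) ^ p = 1 := by
    simp only [hw]
    field_simp
  have hconv : geomConv θ w k * ((m : ℝ) + k) ^ p =
      ∑ l ∈ Finset.range (k + 1), θ ^ l * (((m : ℝ) + k) / (m + (k - l : ℕ))) ^ p := by
    rw [geomConv, Finset.sum_mul]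
    refine Finset.sum_congr rfl fun l _ => ?_
    rw [Real.div_rpow (by positivity) (by positivity)]
    simp only [hw]
    ring
  have hsplit := sum_geom_mul_ratio_rpow_le hθ0 hθ1 hm2 hp.le k
  have hfar := rpow_half_mul_le hθ0 hmpos hp.le hMpos hMk hquad
  have hmid := mul_le_mul_of_nonneg_right (rpow_sqrt_mul_le hθ0 hθ1 hMpos hMk hM4)
    (by positivity : (0 : ℝ) ≤ 2 ^ p)
  have hnear : 1 / (1 - θ) * (((m : ℝ) + k) / (m + k - Real.sqrt k - 1)) ^ p ≤
      1 / (1 - θ) * (((m : ℝ) + M) / (m + M - Real.sqrt M - 1)) ^ p := by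
    have h1 : 0 ≤ 1 / (1 - θ) := one_div_nonneg.2 (by linarith)
    have h2 := sub_sqrt_sub_one_pos hm2 (Nat.cast_nonneg (α := ℝ) k)
    exact mul_le_mul_of_nonneg_left
      (Real.rpow_le_rpow (by positivity) (div_sub_sqrt_le hm2 hMm hMk) hp.le) h1
  have hη0 : 0 ≤ η * Y / C₁ := by
    have : 0 < 1 - θ ^ 2 := sub_pos.2 (pow_lt_one₀ hθ0.le hθ1 two_ne_zero)
    rw [hη]
    positivity
  calc |Uinv c d z k| * ((m : ℝ) + k) ^ p
      ≤ Y / C₁ / γ * ((geomConv θ w k + w k * (θ / (1 - θ))) / (1 - θ ^ 2)) *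
          ((m : ℝ) + k) ^ p := by gcongr
    _ = η * Y / C₁ * (geomConv θ w k * ((m : ℝ) + k) ^ p +
          w k * ((m : ℝ) + k) ^ p * (θ / (1 - θ))) := by
        rw [hη]
        simp only [div_eq_mul_inv, mul_inv]
        ring
    _ ≤ _ := by
        rw [hwk, one_mul, hconv]
        refine mul_le_mul_of_nonneg_left (add_le_add_left (hsplit.trans ?_) _) hη0
        exact add_le_add (add_le_add hfar hmid) hnear
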